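/- Let the Changhee polynomials Ch_n(x) be defined by Ch_0(x) = 1 and the recurrence 2·Ch_n(x) + n·Ch_{n-1}(x) = 2·(x)_n for n ≥ 1, and for every x ∈ ℝ and N ≥ 0 and t with |t| < 1, let F^{(N)}(t,x) denote the N-th derivative with respect to t of F(t,x) = (1+t)^x/(2+t). Then 2·F^{(N)}(t,x) = Σ_{k=0}^{∞} Ch_{N+k}(x)·t^k/k!, the series converging for |t| < 1. -/

import Mathlib

/-- The derivative of a power series `∑ aₙ tⁿ / n!` converging on the unit interval is obtained
by shifting the sequence `a`. -/
theorem hasSum_exponential_series_deriv {a : ℕ → ℝ} {f : ℝ → ℝ}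
    (h : ∀ t : ℝ, |t| < 1 → HasSum (fun k : ℕ => a k * t ^ k / k.factorial) (f t))
    {t : ℝ} (ht : |t| < 1) :
    HasSum (fun k : ℕ => a (k + 1) * t ^ k / k.factorial) (deriv f t) := by
  let p := FormalMultilinearSeries.ofScalars ℝ fun n => a n / n.factorial
  have mem_ball_iff (y : ℝ) : y ∈ Metric.eball (0 : ℝ) 1 ↔ |y| < 1 := by
    rw [← ENNReal.ofReal_one, Metric.eball_ofReal]
    simp
  have hp : HasFPowerSeriesOnBall f p 0 1 := by
    refine ⟨?_, one_pos, fun {y} hy => ?_⟩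
    · refine ENNReal.le_of_forall_nnreal_lt fun r hr => ?_
      have hr1 : |(r : ℝ)| < 1 := by
        rw [NNReal.abs_eq]
        exact_mod_cast hr
      refine p.le_radius_of_tendsto (l := 0) ?_
      convert! (h r hr1).summable.norm.tendsto_atTop_zero using 2 with n
      simp [p, div_mul_eq_mul_div]
    · have hy' := h y ((mem_ball_iff y).1 hy)
      rw [zero_add]
      convert! hy' using 2 with n
      simp [p, FormalMultilinearSeries.coeff_ofScalars]
      ring
  have hs := hp.fderiv.hasSum ((mem_ball_iff t).2 ht)
  have hs1 := hs.mapL (ContinuousLinearMap.apply ℝ ℝ (1 : ℝ))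
  rw [zero_add] at hs1
  convert! hs1 using 2 with n
  simp [p, FormalMultilinearSeries.coeff_ofScalars, FormalMultilinearSeries.derivSeries_coeff_one,
    Nat.factorial_succ]
  field_simp

theorem hasSum_exponential_series_iteratedDeriv {a : ℕ → ℝ} {f : ℝ → ℝ}
    (h : ∀ t : ℝ, |t| < 1 → HasSum (fun k : ℕ => a k * t ^ k / k.factorial) (f t))
    (N : ℕ) {t : ℝ} (ht : |t| < 1) :
    HasSum (fun k : ℕ => a (N + k) * t ^ k / k.factorial) (iteratedDeriv N f t) := by
  induction N generalizing a f with
  | zero => simpa using h t ht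
  | succ N ih =>
    rw [iteratedDeriv_succ']
    convert! ih fun s hs => hasSum_exponential_series_deriv h hs using 5
    ring

theorem factorial_mul_choose_eq_prod_range (x : ℝ) (n : ℕ) :
    n.factorial * Ring.choose x n = ∏ k ∈ Finset.range n, (x - k) := by
  rw [← nsmul_eq_mul, ← Ring.descPochhammer_eq_factorial_smul_choose]
  induction n with
  | zero => simp
  | succ n ih =>
    simp [descPochhammer_succ_right, Polynomial.smeval_mul, Polynomial.smeval_natCast,
      Finset.prod_range_succ, ih]

theorem hasSum_choose_mul_pow (x : ℝ) {t : ℝ} (ht : |t| < 1) :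
    HasSum (fun n : ℕ => Ring.choose x n * t ^ n) ((1 + t) ^ x) := by
  have hmem : t ∈ Metric.eball (0 : ℝ) 1 := by
    rw [← ENNReal.ofReal_one, Metric.eball_ofReal]
    simpa using ht
  have hs := (Real.one_add_rpow_hasFPowerSeriesOnBall_zero (a := x)).hasSum hmem
  rw [zero_add] at hs
  convert! hs using 2 with n
  rw [binomialSeries_apply]
  simp

/-- The values `Ch_n(x) / n!` are the Cauchy product of the binomial and geometric coefficients. -/
theorem changhee_div_factorial_eq_sum {c : ℕ → ℝ} {x : ℝ} (h0 : c 0 = 1)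
    (hrec : ∀ n : ℕ, 2 * c (n + 1) + (n + 1) * c n =
      2 * ∏ k ∈ Finset.range (n + 1), (x - k)) (n : ℕ) :
    c n / n.factorial =
      ∑ k ∈ Finset.range (n + 1), Ring.choose x k * (-1 / 2) ^ (n - k) := by
  induction n with
  | zero => simp [h0]
  | succ n ih =>
    have hsum : ∑ k ∈ Finset.range (n + 1), Ring.choose x k * (-1 / 2 : ℝ) ^ (n + 1 - k) =
        (∑ k ∈ Finset.range (n + 1), Ring.choose x k * (-1 / 2) ^ (n - k)) * (-1 / 2) := by
      rw [Finset.sum_mul]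
      refine Finset.sum_congr rfl fun k hk => ?_
      rw [Nat.sub_add_comm (Finset.mem_range_succ_iff.1 hk), pow_succ, mul_assoc]
    rw [Finset.sum_range_succ, hsum, ← ih, Nat.sub_self, pow_zero, mul_one]
    have hr := hrec n
    rw [← factorial_mul_choose_eq_prod_range, Nat.factorial_succ] at hr
    rw [Nat.factorial_succ]
    push_cast at hr ⊢
    field_simp
    linarith

theorem changhee_generating_function {c : ℕ → ℝ} {x : ℝ} (h0 : c 0 = 1)
    (hrec : ∀ n : ℕ, 2 * c (n + 1) + (n + 1) * c n =
      2 * ∏ k ∈ Finset.range (n + 1), (x - k)) {t : ℝ} (ht : |t| < 1) :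
    HasSum (fun k : ℕ => c k * t ^ k / k.factorial) (2 * ((1 + t) ^ x / (2 + t))) := by
  have hb := hasSum_choose_mul_pow x ht
  obtain ⟨hl, hu⟩ := abs_lt.1 ht
  have hq : |-1 / 2 * t| < 1 := abs_lt.2 ⟨by linarith, by linarith⟩
  have hg := hasSum_geometric_of_abs_lt_one hq
  have hs := hasSum_sum_range_mul_of_summable_norm hb.summable.norm hg.summable.norm
  rw [hb.tsum_eq, hg.tsum_eq] at hs
  convert! hs using 1
  · ext n
    rw [mul_div_right_comm, changhee_div_factorial_eq_sum h0 hrec, Finset.sum_mul]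
    refine Finset.sum_congr rfl fun k hk => ?_
    rw [← pow_mul_pow_sub t (Finset.mem_range_succ_iff.1 hk), mul_pow]
    ring
  · have h2 : 2 + t ≠ 0 := by linarith
    have h1 : 1 - -1 / 2 * t = (2 + t) / 2 := by ring
    rw [h1]
    field_simp


/-- `2·F^{(N)}(t,x) = Σ_{k≥0} Ch_{N+k}(x) t^k/k!` for `|t| < 1`,
where `F(t,x) = (1+t)^x/(2+t)`. -/
theorem changhee_shifted_generating_function (Ch : ℕ → ℝ → ℝ)
    (hCh0 : ∀ x : ℝ, Ch 0 x = 1)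
    (hChrec : ∀ (n : ℕ) (x : ℝ),
      2 * Ch (n + 1) x + (n + 1) * Ch n x =
        2 * ∏ k ∈ Finset.range (n + 1), (x - k)) :
    ∀ (x : ℝ) (N : ℕ) (t : ℝ), |t| < 1 →
      HasSum (fun k : ℕ => Ch (N + k) x * t ^ k / k.factorial)
        (2 * iteratedDeriv N (fun s : ℝ => (1 + s) ^ x / (2 + s)) t) := by
  intro x N t ht
  have h := hasSum_exponential_series_iteratedDeriv (fun s hs =>
    changhee_generating_function (c := fun n => Ch n x) (hCh0 x) (fun n => hChrec n x) hs) N ht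
  rwa [iteratedDeriv_const_mul_field] at h
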